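/- For every integer k ≥ 3, the string w_k = b · F*_{2k} over the alphabet {a, b} with a < b satisfies BBWT(w_k) = b^{f_{2k-2}} a^{f_{2k-1}} b, and consequently r_B(w_k) = 3. -/

import Mathlib

/-! Basic definitions: strings as `List α`, rotations, runs, BWT, Lyndon
factorization, ω-order, bijective BWT, and Fibonacci words. -/

variable {α : Type*}

/-- Left cyclic rotation by one symbol. -/
def rot (x : List α) : List α := x.drop 1 ++ x.take 1

/-- The list of all `|x|` cyclic rotations of `x`. -/
def rotations (x : List α) : List (List α) :=
  (List.range x.length).map (fun i => rot^[i] x)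

/-- ρ: the number of maximal runs of equal consecutive symbols. -/
def runsCount [DecidableEq α] : List α → ℕ
  | [] => 0
  | [_] => 1
  | a :: b :: t => (if a = b then 0 else 1) + runsCount (b :: t)

/-- The Burrows–Wheeler transform: last symbols of the lexicographically
sorted rotations. -/
def BWT [LinearOrder α] (w : List α) : List α :=
  (List.insertionSort (· ≤ ·) (rotations w)).filterMap List.getLast?

/-- The lexicographically smallest rotation of `x`. -/
def lexMinRotation [LinearOrder α] (x : List α) : List α :=
  (List.insertionSort (· ≤ ·) (rotations x)).headD x

/-- A Lyndon word: nonempty and strictly smaller than all its proper rotations. -/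
def IsLyndon [LinearOrder α] (x : List α) : Prop :=
  x ≠ [] ∧ ∀ i < x.length, 0 < i → x < rot^[i] x

instance [LinearOrder α] : DecidablePred (IsLyndon (α := α)) := fun _ =>
  inferInstanceAs (Decidable (_ ∧ _))

/-- The longest prefix of `w` that is a Lyndon word (the first Lyndon factor). -/
def firstLyndonFactor [LinearOrder α] (w : List α) : List α :=
  (((List.range (w.length + 1)).map (fun i => w.take i)).filter
    (fun x => decide (IsLyndon x))).getLastD []

def lyndonFactAux [LinearOrder α] : ℕ → List α → List (List α)
  | 0, _ => []
  | _, [] => []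
  | fuel+1, w =>
      let p := firstLyndonFactor w
      if p.isEmpty then [] else p :: lyndonFactAux fuel (w.drop p.length)

/-- The Lyndon factorization of `w`: repeatedly peel off the longest Lyndon
prefix (equivalently, the unique nonincreasing factorization into Lyndon words). -/
def lyndonFactorization [LinearOrder α] (w : List α) : List (List α) :=
  lyndonFactAux w.length w

/-- `listPow x n = x^n`. -/
def listPow (x : List α) : ℕ → List α
  | 0 => []
  | n+1 => x ++ listPow x n

/-- ω-order: `x ≤ω y` iff `x^∞ ≤ y^∞` lexicographically; comparing the
equal-length words `x^{|y|}` and `y^{|x|}` is equivalent. -/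
def omegaLE [LinearOrder α] (x y : List α) : Prop :=
  listPow x y.length ≤ listPow y x.length

instance [LinearOrder α] : DecidableRel (omegaLE (α := α)) := fun _ _ =>
  inferInstanceAs (Decidable (_ ≤ _))

/-- The bijective Burrows–Wheeler transform: last symbols of all rotations of
all Lyndon factors of `w`, sorted in ω-order. -/
def BBWT [LinearOrder α] (w : List α) : List α :=
  (List.insertionSort omegaLE
    (((lyndonFactorization w).map rotations).flatten)).filterMap List.getLast?

/-- Fibonacci words over symbols `a < b`: `F 0 = b`, `F 1 = a`,
`F (i+2) = F (i+1) ++ F i`. -/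
def fibWordG (a b : α) : ℕ → List α
  | 0 => [b]
  | 1 => [a]
  | n+2 => fibWordG a b (n+1) ++ fibWordG a b n

/-- Fibonacci words over `Fin 2` with `a = 0 < b = 1`. -/
def fibWord : ℕ → List (Fin 2) := fibWordG 0 1

theorem rot_iterate (x : List α) (i : ℕ) : rot^[i] x = x.rotate i := by
  have h1 : ∀ y : List α, rot y = y.rotate 1 := by
    intro y
    cases y with
    | nil => rfl
    | cons a t => simp [rot]
  induction i with
  | zero => simp
  | succ i ih => rw [Function.iterate_succ_apply', ih, h1, List.rotate_rotate]

theorem mem_rotations {x y : List α} (hx : x ≠ []) :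
    y ∈ rotations x ↔ ∃ r, y = x.rotate r := by
  simp only [rotations, List.mem_map, List.mem_range, rot_iterate]
  constructor
  · rintro ⟨i, -, rfl⟩
    exact ⟨i, rfl⟩
  · rintro ⟨r, rfl⟩
    exact ⟨r % x.length, Nat.mod_lt _ (List.length_pos_iff.2 hx), List.rotate_mod x r⟩

theorem length_rotations (x : List α) : (rotations x).length = x.length := by
  simp [rotations]

section Order

variable [LinearOrder α]

theorem append_lt_append_of_length_eq {x y : List α} (h : x < y) (hl : x.length = y.length)
    (u v : List α) : x ++ u < y ++ v := by
  induction x generalizing y with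
  | nil =>
    cases y with
    | nil => exact absurd h (lt_irrefl _)
    | cons b s => simp at hl
  | cons a t ih =>
    cases y with
    | nil => simp at hl
    | cons b s =>
      rw [List.cons_append, List.cons_append, List.cons_lt_cons_iff]
      rcases List.cons_lt_cons_iff.1 h with h | ⟨h, h'⟩
      · exact Or.inl h
      · exact Or.inr ⟨h, ih h' (by simpa using hl)⟩

theorem append_lt_append_left_of_lt (z : List α) {x y : List α} (h : x < y) :
    z ++ x < z ++ y := by
  induction z with
  | nil => simpa
  | cons a t ih => exact List.cons_lt_cons_iff.2 (Or.inr ⟨rfl, ih⟩)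

theorem listPow_lt_listPow {x y : List α} (h : x < y) (hl : x.length = y.length) {n : ℕ}
    (hn : 0 < n) : listPow x n < listPow y n := by
  obtain ⟨m, rfl⟩ := Nat.exists_eq_succ_of_ne_zero hn.ne'
  exact append_lt_append_of_length_eq h hl _ _

theorem omegaLE_iff_le {x y : List α} (hl : x.length = y.length) : omegaLE x y ↔ x ≤ y := by
  unfold omegaLE
  rw [hl]
  rcases Nat.eq_zero_or_pos y.length with h0 | h0
  · have hy := List.length_eq_zero_iff.1 h0
    have hx := List.length_eq_zero_iff.1 (hl.trans h0)
    subst hx hy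
    simp
  rcases lt_trichotomy x y with h | rfl | h
  · exact iff_of_true (listPow_lt_listPow h hl h0).le h.le
  · exact iff_of_true le_rfl le_rfl
  · exact iff_of_false (listPow_lt_listPow h hl.symm h0).not_ge h.not_ge

theorem insertionSort_omegaLE_rotations (x : List α) :
    List.insertionSort omegaLE (rotations x) = List.insertionSort (· ≤ ·) (rotations x) := by
  have hlen : ∀ y ∈ rotations x, y.length = x.length := by
    simp only [rotations, List.mem_map, rot_iterate]
    rintro y ⟨i, -, rfl⟩
    simp
  have h := List.map_insertionSort omegaLE (· ≤ ·) id (rotations x)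
    fun a ha b hb => omegaLE_iff_le ((hlen a ha).trans (hlen b hb).symm)
  simpa using h

theorem insertionSort_rotations_eq {x : List α} {l : List (List α)} (hx : x ≠ [])
    (hs : l.Pairwise (· < ·)) (hl : l.length = x.length)
    (hm : ∀ y ∈ l, ∃ r, y = x.rotate r) :
    (rotations x).Perm l ∧ List.insertionSort (· ≤ ·) (rotations x) = l := by
  have hnd : l.Nodup := hs.imp fun h => h.ne
  have hp : l.Perm (rotations x) :=
    (List.subperm_of_subset hnd fun y hy => (mem_rotations hx).2 (hm y hy)).perm_of_length_le
      (by rw [length_rotations, hl])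
  refine ⟨hp.symm, ?_⟩
  exact ((List.perm_insertionSort _ _).trans hp.symm).eq_of_pairwise
    (fun a b _ _ h1 h2 => le_antisymm h1 h2) (List.pairwise_insertionSort _ _)
    (hs.imp fun h => h.le)

theorem firstLyndonFactor_of_isLyndon {w : List α} (hw : IsLyndon w) :
    firstLyndonFactor w = w := by
  simp [firstLyndonFactor, List.range_succ, hw]

theorem isLyndon_singleton (a : α) : IsLyndon [a] :=
  ⟨by simp, fun i hi h0 => by simp at hi; omega⟩

theorem firstLyndonFactor_cons_cons {a b : α} (hab : b < a) (t : List α) :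
    firstLyndonFactor (a :: b :: t) = [a] := by
  have hnil : ¬ IsLyndon ([] : List α) := fun h => h.1 rfl
  have hlong : ∀ i, ¬ IsLyndon (a :: b :: t.take i) := by
    intro i h
    have h1 := h.2 1 (by simp) one_pos
    rw [rot_iterate] at h1
    simp only [List.rotate_cons_succ, List.rotate_zero, List.cons_append,
      List.cons_lt_cons_iff] at h1
    rcases h1 with h1 | ⟨h1, -⟩
    · exact lt_asymm hab h1
    · exact hab.ne' h1
  have hfil : (List.range (t.length + 1)).filter
      (fun i => decide (IsLyndon (a :: b :: t.take i))) = [] := by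
    simp [hlong]
  simp only [firstLyndonFactor, List.length_cons]
  rw [List.range_succ_eq_map, List.range_succ_eq_map]
  simp [hnil, isLyndon_singleton, hlong, List.filter_map, Function.comp_def]

theorem lyndonFactorization_of_isLyndon_cons {a b : α} {t : List α} (hab : b < a)
    (h : IsLyndon (b :: t)) : lyndonFactorization (a :: b :: t) = [[a], b :: t] := by
  have hnil : ∀ m, lyndonFactAux m ([] : List α) = [] := by
    intro m; cases m <;> simp [lyndonFactAux]
  simp [lyndonFactorization, lyndonFactAux, firstLyndonFactor_cons_cons hab,
    firstLyndonFactor_of_isLyndon h, hnil]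

end Order

theorem lt_replicate_one {x : List (Fin 2)} (h : 0 ∈ x) : x < List.replicate x.length 1 := by
  induction x with
  | nil => simp at h
  | cons a t ih =>
    rw [List.length_cons, List.replicate_succ, List.cons_lt_cons_iff]
    by_cases ha : a = 0
    · exact Or.inl (by simp [ha])
    · have ha1 : a = 1 := by omega
      refine Or.inr ⟨ha1, ih ?_⟩
      rcases List.mem_cons.1 h with h | h
      · exact absurd h.symm ha
      · exact h

theorem listPow_singleton (a : α) (n : ℕ) : listPow [a] n = List.replicate n a := by
  induction n with
  | zero => rfl
  | succ n ih => simp [listPow, ih, List.replicate_succ]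

theorem not_omegaLE_one {x : List (Fin 2)} (h : 0 ∈ x) : ¬ omegaLE [1] x := by
  simpa [omegaLE, listPow_singleton, listPow] using lt_replicate_one h

theorem orderedInsert_eq_append {β : Type*} (r : β → β → Prop) [DecidableRel r] (a : β)
    (l : List β) (h : ∀ b ∈ l, ¬ r a b) : l.orderedInsert r a = l ++ [a] := by
  induction l with
  | nil => rfl
  | cons b t ih =>
    simp only [List.mem_cons, forall_eq_or_imp] at h
    simp [List.orderedInsert, h.1, ih h.2]

theorem BBWT_one_cons {t : List (Fin 2)} (h : IsLyndon (0 :: t)) :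
    BBWT (1 :: 0 :: t) = BWT (0 :: t) ++ [1] := by
  have hmem : ∀ y ∈ List.insertionSort (· ≤ ·) (rotations (0 :: t)), ¬ omegaLE [1] y := by
    intro y hy
    rw [List.mem_insertionSort, mem_rotations (by simp)] at hy
    obtain ⟨r, rfl⟩ := hy
    exact not_omegaLE_one (by simp)
  have hrot : rotations ([1] : List (Fin 2)) = [[1]] := rfl
  rw [BBWT, lyndonFactorization_of_isLyndon_cons (by decide) h]
  simp only [List.map_cons, List.map_nil, List.flatten_cons, List.flatten_nil, List.append_nil,
    hrot, List.singleton_append, List.insertionSort_cons, insertionSort_omegaLE_rotations]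
  rw [orderedInsert_eq_append _ _ _ hmem, List.filterMap_append, BWT]
  rfl

section SwapRotation

variable {P : List (Fin 2)} {q r : ℕ}

theorem rotate_of_le_length (u : List α) (v : List α) (h : r ≤ u.length) :
    (u ++ v).rotate r = u.drop r ++ v ++ u.take r := by
  rw [List.rotate_eq_drop_append_take (by simp; omega), List.drop_append_of_le_length h,
    List.take_append_of_le_length h]

theorem rotate_append_pair (hr : r % (P.length + 2) ≠ P.length + 1) (c d : Fin 2) :
    (P ++ [c, d]).rotate r
      = P.drop (r % (P.length + 2)) ++ [c, d] ++ P.take (r % (P.length + 2)) := by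
  have hlt := Nat.mod_lt r (show 0 < P.length + 2 by omega)
  rw [← rotate_of_le_length _ _ (show r % (P.length + 2) ≤ P.length by omega),
    ← List.rotate_mod]
  simp

theorem rotate_lt_rotate_add (hq : (P ++ [0, 1]).rotate q = P ++ [1, 0])
    (hr : r % (P.length + 2) ≠ P.length + 1) :
    (P ++ [0, 1]).rotate r < (P ++ [0, 1]).rotate (q + r) := by
  rw [← List.rotate_rotate, hq, rotate_append_pair hr, rotate_append_pair hr,
    List.append_assoc, List.append_assoc]
  exact append_lt_append_left_of_lt _ (List.cons_lt_cons_iff.2 (Or.inl (by decide)))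

theorem getLast?_rotate_add (hq : (P ++ [0, 1]).rotate q = P ++ [1, 0])
    (hr : r % (P.length + 2) ≠ P.length + 1) (hr0 : r % (P.length + 2) ≠ 0) :
    ((P ++ [0, 1]).rotate (q + r)).getLast? = ((P ++ [0, 1]).rotate r).getLast? := by
  have hlt := Nat.mod_lt r (show 0 < P.length + 2 by omega)
  have hne : P.take (r % (P.length + 2)) ≠ [] := by
    rw [← List.length_pos_iff, List.length_take]
    omega
  rw [← List.rotate_rotate, hq, rotate_append_pair hr, rotate_append_pair hr,
    List.getLast?_append_of_ne_nil _ hne,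
    List.getLast?_append_of_ne_nil _ hne]


variable {p c : ℕ}

theorem dvd_of_add_mul_mod_eq {N m : ℕ} (hc : p * q = 1 + c * (N + 1))
    (h : (N + q * m) % (N + 1) = N) : N + 1 ∣ m := by
  have h1 := Nat.div_add_mod (N + q * m) (N + 1)
  rw [h] at h1
  have h2 : q * m = (N + 1) * ((N + q * m) / (N + 1)) := by omega
  refine (Nat.dvd_add_left (c := c * (N + 1) * m) ⟨c * m, by ring⟩).1
    ⟨p * ((N + q * m) / (N + 1)), ?_⟩
  calc m + c * (N + 1) * m = p * q * m := by rw [hc]; ring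
    _ = p * (q * m) := by ring
    _ = p * ((N + 1) * ((N + q * m) / (N + 1))) := congrArg _ h2
    _ = _ := Nat.mul_left_comm _ _ _

theorem eq_of_add_mul_mod_eq_zero {N m : ℕ} (hc : p * q = 1 + c * (N + 1))
    (hp : 0 < p) (hp' : p ≤ N) (hm : 0 < m) (hm' : m ≤ N + 1)
    (h : (N + q * m) % (N + 1) = 0) : m = p := by
  obtain ⟨t, ht⟩ := Nat.dvd_of_mod_eq_zero h
  have hd : ((N : ℤ) + 1) ∣ m - p := by
    refine ⟨p * t - p - c * m, ?_⟩
    have hc' : (p : ℤ) * q = 1 + c * (N + 1) := by exact_mod_cast hc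
    have ht' : (N : ℤ) + q * m = (N + 1) * t := by exact_mod_cast ht
    linear_combination (p : ℤ) * ht' - (m : ℤ) * hc'
  have := Int.eq_zero_of_abs_lt_dvd hd (by rw [abs_lt]; omega)
  omega

/-- The `j`-th smallest rotation of `P ++ [0, 1]`, when `q` is the rotation amount that swaps
its last two letters. -/
def sortedRotation (P : List (Fin 2)) (q j : ℕ) : List (Fin 2) :=
  (P ++ [0, 1]).rotate (P.length + 1 + q * (j + 1))

theorem sortedRotation_eq_rotate_zero (P : List (Fin 2)) (q j : ℕ) :
    sortedRotation P q j = (sortedRotation P q 0).rotate (q * j) := by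
  rw [sortedRotation, sortedRotation, List.rotate_rotate]
  congr 1
  ring

theorem length_sortedRotation (P : List (Fin 2)) (q j : ℕ) :
    (sortedRotation P q j).length = P.length + 2 := by
  simp [sortedRotation]

theorem sortedRotation_succ (P : List (Fin 2)) (q j : ℕ) :
    sortedRotation P q (j + 1)
      = (P ++ [0, 1]).rotate (q + (P.length + 1 + q * (j + 1))) := by
  rw [sortedRotation]
  congr 1
  ring

theorem sortedRotation_lt (hq : (P ++ [0, 1]).rotate q = P ++ [1, 0])
    (hc : p * q = 1 + c * (P.length + 2)) {i j : ℕ} (hij : i < j) (hj : j < P.length + 2) :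
    sortedRotation P q i < sortedRotation P q j := by
  have step : ∀ j, j + 1 < P.length + 2 →
      sortedRotation P q j < sortedRotation P q (j + 1) := by
    intro j hj
    rw [sortedRotation_succ]
    refine rotate_lt_rotate_add hq fun h => ?_
    have := Nat.le_of_dvd (Nat.succ_pos j) (dvd_of_add_mul_mod_eq (N := P.length + 1) hc h)
    omega
  induction j, hij using Nat.le_induction with
  | base => exact step i hj
  | succ j _ ih => exact (ih (by omega)).trans (step j hj)

theorem getLast?_sortedRotation_eq (hq : (P ++ [0, 1]).rotate q = P ++ [1, 0])
    (hc : p * q = 1 + c * (P.length + 2)) (hp : 0 < p) (hp' : p < P.length + 2) {i j : ℕ}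
    (hij : i ≤ j) (hj : j < P.length + 2) (h : j < p ∨ p ≤ i) :
    (sortedRotation P q j).getLast? = (sortedRotation P q i).getLast? := by
  induction j, hij using Nat.le_induction with
  | base => rfl
  | succ j hij ih =>
    rw [← ih (by omega) (by omega), sortedRotation_succ]
    refine getLast?_rotate_add hq (fun h' => ?_) fun h' => ?_
    · have := Nat.le_of_dvd (Nat.succ_pos j) (dvd_of_add_mul_mod_eq (N := P.length + 1) hc h')
      omega
    · have := eq_of_add_mul_mod_eq_zero (N := P.length + 1) hc hp (by omega)
        (Nat.succ_pos j) (by omega) h'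
      omega

theorem sortedRotation_pred (hc : p * q = 1 + c * (P.length + 2)) (hp : 0 < p) :
    sortedRotation P q (p - 1) = P ++ [0, 1] := by
  have h : P.length + 1 + q * (p - 1 + 1) = (P ++ [0, 1]).length * (c + 1) := by
    rw [Nat.sub_add_cancel hp, mul_comm q p, hc]
    simp
    ring
  rw [sortedRotation, h, List.rotate_length_mul]

theorem getLast?_sortedRotation_of_lt (hq : (P ++ [0, 1]).rotate q = P ++ [1, 0])
    (hc : p * q = 1 + c * (P.length + 2)) (hp' : p < P.length + 2) {j : ℕ}
    (hj : j < p) : (sortedRotation P q j).getLast? = some 1 := by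
  rw [← getLast?_sortedRotation_eq hq hc (by omega) hp' (show j ≤ p - 1 by omega) (by omega)
    (by omega), sortedRotation_pred hc (by omega)]
  simp

theorem getLast?_sortedRotation_of_le (hq : (P ++ [0, 1]).rotate q = P ++ [1, 0])
    (hc : p * q = 1 + c * (P.length + 2)) (hp : 0 < p) (hp' : p < P.length + 2) {j : ℕ}
    (hj : p ≤ j) (hj' : j < P.length + 2) : (sortedRotation P q j).getLast? = some 0 := by
  have h : sortedRotation P q p = P ++ [1, 0] := by
    rw [← hq, ← sortedRotation_pred hc hp, ← Nat.sub_add_cancel hp, Nat.add_sub_cancel,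
      sortedRotation, sortedRotation, List.rotate_rotate]
    congr 1
    ring
  rw [getLast?_sortedRotation_eq hq hc hp hp' hj hj' (Or.inr le_rfl), h]
  simp

theorem filterMap_getLast?_sortedRotation (hq : (P ++ [0, 1]).rotate q = P ++ [1, 0])
    (hc : p * q = 1 + c * (P.length + 2)) (hp : 0 < p) (hq0 : 0 < q)
    (hpq : p + q = P.length + 2) :
    ((List.range (P.length + 2)).map (sortedRotation P q)).filterMap List.getLast?
      = List.replicate p 1 ++ List.replicate q 0 := by
  have key : ∀ (n : ℕ) (f : ℕ → List (Fin 2)) (a : Fin 2), (∀ i < n, (f i).getLast? = some a) →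
      ((List.range n).map f).filterMap List.getLast? = List.replicate n a := by
    intro n f a h
    induction n with
    | zero => rfl
    | succ n ih =>
      rw [List.range_succ, List.map_append, List.filterMap_append,
        ih fun i hi => h i (by omega), List.replicate_succ']
      simp [h n (by omega)]
  rw [← hpq, List.range_add, List.map_append, List.filterMap_append, List.map_map,
    key p _ 1 fun i hi => getLast?_sortedRotation_of_lt hq hc (by omega) hi,
    key q (sortedRotation P q ∘ fun i => p + i) 0 fun i hi => getLast?_sortedRotation_of_le hq hc hp (by omega)
      (Nat.le_add_right p i) (show p + i < P.length + 2 by omega)]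

theorem pairwise_sortedRotation (hq : (P ++ [0, 1]).rotate q = P ++ [1, 0])
    (hc : p * q = 1 + c * (P.length + 2)) :
    ((List.range (P.length + 2)).map (sortedRotation P q)).Pairwise (· < ·) := by
  rw [List.pairwise_map]
  exact List.pairwise_lt_range.imp_of_mem fun _ hj hij =>
    sortedRotation_lt hq hc hij (List.mem_range.1 hj)

theorem isLyndon_sortedRotation_zero (hq : (P ++ [0, 1]).rotate q = P ++ [1, 0])
    (hc : p * q = 1 + c * (P.length + 2)) : IsLyndon (sortedRotation P q 0) := by
  have hne : sortedRotation P q 0 ≠ [] := by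
    rw [← List.length_pos_iff, length_sortedRotation]; omega
  have hperm := (insertionSort_rotations_eq hne (pairwise_sortedRotation hq hc)
    (by simp [length_sortedRotation]) (by
      intro y hy
      obtain ⟨j, -, rfl⟩ := List.mem_map.1 hy
      exact ⟨_, sortedRotation_eq_rotate_zero P q j⟩)).1
  refine ⟨hne, fun i hi h0 => ?_⟩
  have hmem : rot^[i] (sortedRotation P q 0) ∈ rotations (sortedRotation P q 0) :=
    List.mem_map.2 ⟨i, List.mem_range.2 hi, rfl⟩
  obtain ⟨j, hj, hij⟩ := List.mem_map.1 (hperm.mem_iff.1 hmem)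
  rw [← hij]
  rcases Nat.eq_zero_or_pos j with rfl | hj0
  · have hnd : (rotations (sortedRotation P q 0)).Nodup :=
      hperm.nodup_iff.2 ((pairwise_sortedRotation hq hc).imp fun h => h.ne)
    have := List.inj_on_of_nodup_map hnd (List.mem_range.2 hi)
      (List.mem_range.2 (h0.trans hi)) hij.symm
    omega
  · exact sortedRotation_lt hq hc hj0 (List.mem_range.1 hj)

theorem lexMinRotation_eq_sortedRotation (hq : (P ++ [0, 1]).rotate q = P ++ [1, 0])
    (hc : p * q = 1 + c * (P.length + 2)) :
    lexMinRotation (P ++ [0, 1]) = sortedRotation P q 0 := by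
  rw [lexMinRotation, (insertionSort_rotations_eq (by simp) (pairwise_sortedRotation hq hc)
    (by simp) (by
      intro y hy
      obtain ⟨j, -, rfl⟩ := List.mem_map.1 hy
      exact ⟨_, rfl⟩)).2, List.range_succ_eq_map]
  rfl

theorem BWT_sortedRotation_zero (hq : (P ++ [0, 1]).rotate q = P ++ [1, 0])
    (hc : p * q = 1 + c * (P.length + 2)) (hp : 0 < p) (hq0 : 0 < q)
    (hpq : p + q = P.length + 2) :
    BWT (sortedRotation P q 0) = List.replicate p 1 ++ List.replicate q 0 := by
  have hne : sortedRotation P q 0 ≠ [] := by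
    rw [← List.length_pos_iff, length_sortedRotation]; omega
  rw [BWT, (insertionSort_rotations_eq hne (pairwise_sortedRotation hq hc)
    (by simp [length_sortedRotation]) (by
      intro y hy
      obtain ⟨j, -, rfl⟩ := List.mem_map.1 hy
      exact ⟨_, sortedRotation_eq_rotate_zero P q j⟩)).2,
    filterMap_getLast?_sortedRotation hq hc hp hq0 hpq]

theorem exists_sortedRotation_zero_eq_cons {s : List (Fin 2)} (hs : P ++ [0, 1] = 0 :: s)
    (hq : (P ++ [0, 1]).rotate q = P ++ [1, 0])
    (hc : p * q = 1 + c * (P.length + 2)) (hp : 0 < p) (hp' : p < P.length + 2) :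
    ∃ t, sortedRotation P q 0 = 0 :: t := by
  have hle : sortedRotation P q 0 ≤ 0 :: s := by
    rw [← hs, ← sortedRotation_pred hc hp]
    rcases Nat.eq_zero_or_pos (p - 1) with h | h
    · rw [h]
    · exact (sortedRotation_lt hq hc h (by omega)).le
  have hlen := length_sortedRotation P q 0
  cases hy : sortedRotation P q 0 with
  | nil => simp [hy] at hlen
  | cons a t =>
    rw [hy] at hle
    have ha : ¬ 0 < a := fun ha => not_lt_of_ge hle (List.cons_lt_cons_iff.2 (Or.inl ha))
    exact ⟨t, by rw [show a = 0 by omega]⟩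

theorem BBWT_one_cons_lexMinRotation {s : List (Fin 2)} (hs : P ++ [0, 1] = 0 :: s)
    (hq : (P ++ [0, 1]).rotate q = P ++ [1, 0])
    (hc : p * q = 1 + c * (P.length + 2)) (hp : 0 < p) (hq0 : 0 < q)
    (hpq : p + q = P.length + 2) :
    BBWT (1 :: lexMinRotation (P ++ [0, 1]))
      = List.replicate p 1 ++ List.replicate q 0 ++ [1] := by
  obtain ⟨t, ht⟩ := exists_sortedRotation_zero_eq_cons hs hq hc hp (by omega)
  rw [lexMinRotation_eq_sortedRotation hq hc, ht,
    BBWT_one_cons (ht ▸ isLyndon_sortedRotation_zero hq hc), ← ht,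
    BWT_sortedRotation_zero hq hc hp hq0 hpq]

end SwapRotation

theorem fibWord_add_two (n : ℕ) : fibWord (n + 2) = fibWord (n + 1) ++ fibWord n := rfl

theorem length_fibWord_add_two (n : ℕ) :
    (fibWord (n + 2)).length = (fibWord (n + 1)).length + (fibWord n).length := by
  rw [fibWord_add_two, List.length_append]

theorem length_fibWord_pos (n : ℕ) : 0 < (fibWord n).length := by
  induction n using Nat.twoStepInduction with
  | zero => decide
  | one => decide
  | more n _ ih => rw [length_fibWord_add_two]; omega

theorem exists_fibWord_succ_eq_cons (n : ℕ) : ∃ s, fibWord (n + 1) = 0 :: s := by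
  induction n with
  | zero => exact ⟨[], rfl⟩
  | succ n ih =>
    obtain ⟨s, hs⟩ := ih
    exact ⟨s ++ fibWord n, by rw [fibWord_add_two, hs, List.cons_append]⟩

theorem exists_fibWord_append_comm (n : ℕ) :
    ∃ P, fibWord (2 * n + 1) ++ fibWord (2 * n) = P ++ [0, 1] ∧
      fibWord (2 * n) ++ fibWord (2 * n + 1) = P ++ [1, 0] := by
  induction n with
  | zero => exact ⟨[], rfl, rfl⟩
  | succ n ih =>
    obtain ⟨P, h1, h2⟩ := ih
    refine ⟨fibWord (2 * n + 2) ++ fibWord (2 * n + 1) ++ P, ?_, ?_⟩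
    · rw [Nat.mul_add, mul_one, fibWord_add_two (2 * n + 1), List.append_assoc _ P, ← h1]
      simp [fibWord_add_two (2 * n)]
    · rw [Nat.mul_add, mul_one, fibWord_add_two (2 * n + 1), List.append_assoc _ P, ← h2]
      simp [fibWord_add_two (2 * n)]

theorem length_fibWord_sq (n : ℕ) :
    (fibWord (2 * n + 2)).length ^ 2 = 1 + (fibWord (2 * n + 1)).length ^ 2
      + (fibWord (2 * n + 1)).length * (fibWord (2 * n + 2)).length := by
  induction n with
  | zero => rfl
  | succ n ih =>
    simp only [Nat.mul_add, mul_one]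
    rw [length_fibWord_add_two (2 * n + 2), length_fibWord_add_two (2 * n + 1)]
    linear_combination ih

theorem runsCount_cons_self [DecidableEq α] (a : α) (t : List α) :
    runsCount (a :: a :: t) = runsCount (a :: t) := by
  simp [runsCount]

theorem runsCount_replicate_append [DecidableEq α] {a b : α} (hab : a ≠ b) (t : List α) {n : ℕ}
    (hn : 0 < n) :
    runsCount (List.replicate n a ++ b :: t) = 1 + runsCount (b :: t) := by
  induction n, hn using Nat.le_induction with
  | base => simp [runsCount, hab]
  | succ n hn ih =>
    obtain ⟨m, rfl⟩ := Nat.exists_eq_succ_of_ne_zero (Nat.pos_iff_ne_zero.1 hn)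
    rw [← ih, List.replicate_succ, List.replicate_succ, List.cons_append, List.cons_append,
      runsCount_cons_self]

theorem runsCount_replicate_replicate [DecidableEq α] {a b : α} (hab : a ≠ b) {p q : ℕ}
    (hp : 0 < p) (hq : 0 < q) :
    runsCount (List.replicate p a ++ List.replicate q b ++ [a]) = 3 := by
  have h := runsCount_replicate_append hab.symm [] hq
  obtain ⟨m, rfl⟩ := Nat.exists_eq_succ_of_ne_zero hq.ne'
  rw [List.append_assoc, List.replicate_succ, List.cons_append,
    runsCount_replicate_append hab _ hp, ← List.cons_append, ← List.replicate_succ, h]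
  rfl

/-- for every `k ≥ 3`, `BBWT(b · F*_{2k}) = b^{f_{2k-2}} a^{f_{2k-1}} b`,
hence `r_B(b · F*_{2k}) = 3`. -/
theorem stmt1 (k : ℕ) (hk : 3 ≤ k) :
    BBWT (1 :: lexMinRotation (fibWord (2 * k))) =
      List.replicate (fibWord (2 * k - 2)).length 1 ++
        List.replicate (fibWord (2 * k - 1)).length 0 ++ [1] ∧
    runsCount (BBWT (1 :: lexMinRotation (fibWord (2 * k)))) = 3 := by
  obtain ⟨n, rfl⟩ : ∃ n, k = n + 2 := ⟨k - 2, by omega⟩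
  have h2 : 2 * (n + 2) - 2 = 2 * n + 2 := by omega
  have h1 : 2 * (n + 2) - 1 = 2 * n + 3 := by omega
  obtain ⟨P, hP, hP'⟩ := exists_fibWord_append_comm (n + 1)
  obtain ⟨s, hs⟩ := exists_fibWord_succ_eq_cons (2 * n + 3)
  simp only [Nat.mul_add, mul_one] at hP hP'
  have hF : fibWord (2 * (n + 2)) = P ++ [0, 1] := by
    rw [← hP]
    exact fibWord_add_two (2 * n + 2)
  have hq : (P ++ [0, 1]).rotate (fibWord (2 * n + 3)).length = P ++ [1, 0] := by
    rw [← hP, ← hP']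
    exact List.rotate_append_length_eq _ _
  have hlen : (fibWord (2 * n + 2)).length + (fibWord (2 * n + 3)).length = P.length + 2 := by
    simpa using congrArg List.length hP'
  have hc : (fibWord (2 * n + 2)).length * (fibWord (2 * n + 3)).length
      = 1 + (fibWord (2 * n + 1)).length * (P.length + 2) := by
    rw [← hlen, length_fibWord_add_two (2 * n + 1)]
    linear_combination length_fibWord_sq n
  have hB := BBWT_one_cons_lexMinRotation (hF ▸ hs) hq hc (length_fibWord_pos _)
    (length_fibWord_pos _) hlen
  rw [h1, h2, hF, hB]
  exact ⟨rfl, runsCount_replicate_replicate (by decide) (length_fibWord_pos _)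
    (length_fibWord_pos _)⟩
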